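/- Let k be a field, G a finite group, and w a finite-dimensional kG-module. Let (m_i)_{i≥1} be a sequence of finite-dimensional kG-modules with connecting maps s_i : m_i → m_{i+1} and colimit M, with telescope sequence 0 → ⊕_i m_i →^{1−s} ⊕_i m_i →^{t} M → 0. Let ι : ⊕_i m_i → w ⊗ w* ⊗ (⊕_i m_i) be the unit of the adjunction (the canonical w-split monomorphism), let C be the cokernel of the injective map (1−s, ι) : ⊕_i m_i → (⊕_i m_i) ⊕ (w ⊗ w* ⊗ (⊕_i m_i)), and let λ : C → M be the map induced by (t, 0) (which kills the image of (1−s, ι) since t∘(1−s) = 0). Then for every finite-dimensional kG-module x, composition with λ induces a bijection between Hom_{kG}(x, C) modulo maps factoring through w-projective modules and Hom_{kG}(x, M) modulo maps factoring through w-projective modules. -/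

import Mathlib

open CategoryTheory MonoidalCategory TensorProduct DirectSum

/-- A representation `P` is `w`-projective if it is a direct summand of `w ⊗ N`
(diagonal action) for some representation `N`. -/
def IsRelProj {k G : Type} [Field k] [Group G] (w P : Rep k G) : Prop :=
  ∃ (N : Rep k G) (i : P ⟶ w ⊗ N) (r : w ⊗ N ⟶ P), i ≫ r = 𝟙 P

/-- A `k`-linear map `f` between carriers of representations (with actions `actA`, `actB`)
factors through a `w`-projective module via equivariant maps. -/
def FactorsThroughRelProj {k G : Type} [Field k] [Group G] (w : Rep k G)
    {A B : Type} [AddCommGroup A] [Module k A] [AddCommGroup B] [Module k B]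
    (actA : G → A →ₗ[k] A) (actB : G → B →ₗ[k] B) (f : A →ₗ[k] B) : Prop :=
  ∃ (P : Rep k G), IsRelProj w P ∧
    ∃ (u : A →ₗ[k] P) (v : P →ₗ[k] B),
      (∀ (g : G) (a : A), u (actA g a) = P.ρ g (u a)) ∧
      (∀ (g : G) (p : P), v (P.ρ g p) = actB g (v p)) ∧
      f = v ∘ₗ u

/-- The componentwise action of `g` on a direct sum of representations. -/
def dsAct {k G : Type} [Field k] [Group G] (m : ℕ → Type)
    [∀ i, AddCommGroup (m i)] [∀ i, Module k (m i)]
    (ρm : ∀ i, Representation k G (m i)) (g : G) :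
    (⨁ i, m i) →ₗ[k] ⨁ i, m i :=
  DirectSum.toModule k ℕ _ (fun i => (DirectSum.lof k ℕ m i) ∘ₗ (ρm i g))

/-- The shift map `s` of the telescope of a sequence of modules. -/
def dsShift {k : Type} [Field k] (m : ℕ → Type)
    [∀ i, AddCommGroup (m i)] [∀ i, Module k (m i)]
    (s : ∀ i, m i →ₗ[k] m (i + 1)) : (⨁ i, m i) →ₗ[k] ⨁ i, m i :=
  DirectSum.toModule k ℕ _ (fun i => (DirectSum.lof k ℕ m (i + 1)) ∘ₗ s i)

/-- Helper instance: `AddCommGroup` on a tensor product whose left factor involves a dual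
(the canonical instance, provided explicitly to help instance resolution). -/
noncomputable instance tensorDualAddCommGroup (k : Type) [Field k] (W B : Type)
    [AddCommGroup W] [Module k W] [AddCommGroup B] [Module k B] :
    AddCommGroup ((W ⊗[k] Module.Dual k W) ⊗[k] B) :=
  letI : AddCommGroup (W ⊗[k] Module.Dual k W) := inferInstance
  inferInstance

/-- The carrier of the homotopy colimit: the cokernel of
`(1 - s, ι) : ⊕ mᵢ → (⊕ mᵢ) ⊕ (w ⊗ w* ⊗ ⊕ mᵢ)`. -/
abbrev HocolimCarrier {k : Type} [Field k] (m : ℕ → Type)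
    [∀ i, AddCommGroup (m i)] [∀ i, Module k (m i)]
    (W : Type) [AddCommGroup W] [Module k W]
    (s : ∀ i, m i →ₗ[k] m (i + 1))
    (ι : (⨁ i, m i) →ₗ[k] (W ⊗[k] Module.Dual k W) ⊗[k] ⨁ i, m i) : Type :=
  ((⨁ i, m i) × ((W ⊗[k] Module.Dual k W) ⊗[k] ⨁ i, m i)) ⧸
    LinearMap.range ((LinearMap.id - dsShift m s : (⨁ i, m i) →ₗ[k] ⨁ i, m i).prod ι)

section RelativeProjectivity

variable {k G : Type} [Field k] [Group G]
  {W : Type} [AddCommGroup W] [Module k W] (ρw : Representation k G W)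
  {N : Type} [AddCommGroup N] [Module k N] (ρN : Representation k G N)
  {A : Type} [AddCommGroup A] [Module k A] {B : Type} [AddCommGroup B] [Module k B]

/-- A map factoring equivariantly through `w ⊗ N` factors through a `w`-projective module. -/
theorem FactorsThroughRelProj.of_tensor {actA : G → A →ₗ[k] A} {actB : G → B →ₗ[k] B}
    (u : A →ₗ[k] W ⊗[k] N) (v : W ⊗[k] N →ₗ[k] B)
    (hu : ∀ g a, u (actA g a) = TensorProduct.map (ρw g) (ρN g) (u a))
    (hv : ∀ g p, v (TensorProduct.map (ρw g) (ρN g) p) = actB g (v p)) :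
    FactorsThroughRelProj (Rep.of ρw) actA actB (v ∘ₗ u) :=
  ⟨Rep.of ρw ⊗ Rep.of ρN, ⟨Rep.of ρN, 𝟙 _, 𝟙 _, by simp⟩, u, v, hu, hv, rfl⟩

/-- A map factoring through a `w`-projective module factors equivariantly through some `w ⊗ N`. -/
theorem FactorsThroughRelProj.exists_tensor {actA : G → A →ₗ[k] A} {actB : G → B →ₗ[k] B}
    {f : A →ₗ[k] B} (h : FactorsThroughRelProj (Rep.of ρw) actA actB f) :
    ∃ (N : Rep.{0} k G) (u : A →ₗ[k] W ⊗[k] N) (v : W ⊗[k] N →ₗ[k] B),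
      (∀ g a, u (actA g a) = TensorProduct.map (ρw g) (N.ρ g) (u a)) ∧
      (∀ g p, v (TensorProduct.map (ρw g) (N.ρ g) p) = actB g (v p)) ∧ f = v ∘ₗ u := by
  obtain ⟨P, ⟨N, i, r, hir⟩, u, v, hu, hv, rfl⟩ := h
  refine ⟨N, i.hom.toLinearMap ∘ₗ u, v ∘ₗ r.hom.toLinearMap, fun g a => ?_, fun g p => ?_, ?_⟩
  · simp only [LinearMap.comp_apply, hu]
    exact Rep.hom_comm_apply i g (u a)
  · simp only [LinearMap.comp_apply, ← hv]
    exact congrArg v (Rep.hom_comm_apply r g p)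
  · ext a
    have := congrArg (fun φ : P ⟶ P => φ.hom (u a)) hir
    exact congrArg v this.symm

theorem FactorsThroughRelProj.zero {actA : G → A →ₗ[k] A} {actB : G → B →ₗ[k] B} :
    FactorsThroughRelProj (Rep.of ρw) actA actB (0 : A →ₗ[k] B) := by
  simpa using FactorsThroughRelProj.of_tensor (actA := actA) (actB := actB) ρw
    (Representation.trivial k G k) 0 0 (by simp) (by simp)

/-- Maps factoring through `w`-projective modules are closed under addition. -/
theorem FactorsThroughRelProj.add {actA : G → A →ₗ[k] A} {actB : G → B →ₗ[k] B}
    {f f' : A →ₗ[k] B} (h : FactorsThroughRelProj (Rep.of ρw) actA actB f)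
    (h' : FactorsThroughRelProj (Rep.of ρw) actA actB f') :
    FactorsThroughRelProj (Rep.of ρw) actA actB (f + f') := by
  obtain ⟨N, u, v, hu, hv, rfl⟩ := h.exists_tensor
  obtain ⟨N', u', v', hu', hv', rfl⟩ := h'.exists_tensor
  have key (g : G) (N₁ N₂ : Rep.{0} k G) (φ : N₁ →ₗ[k] N₂)
      (hφ : φ ∘ₗ N₁.ρ g = N₂.ρ g ∘ₗ φ) (p : W ⊗[k] N₁) :
      LinearMap.lTensor W φ (TensorProduct.map (ρw g) (N₁.ρ g) p) =
        TensorProduct.map (ρw g) (N₂.ρ g) (LinearMap.lTensor W φ p) := by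
    simp only [← LinearMap.comp_apply, LinearMap.lTensor, ← TensorProduct.map_comp, hφ,
      LinearMap.id_comp, LinearMap.comp_id]
  let Q : Rep.{0} k G := Rep.of (N.ρ.prod N'.ρ)
  have h₁ (g : G) (p : W ⊗[k] N) := key g N Q (LinearMap.inl k N N') (by ext <;> simp [Q]) p
  have h₂ (g : G) (p : W ⊗[k] N') := key g N' Q (LinearMap.inr k N N') (by ext <;> simp [Q]) p
  have h₃ (g : G) (p : W ⊗[k] Q) := key g Q N (LinearMap.fst k N N') (by ext <;> simp [Q]) p
  have h₄ (g : G) (p : W ⊗[k] Q) := key g Q N' (LinearMap.snd k N N') (by ext <;> simp [Q]) p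
  have hQ := FactorsThroughRelProj.of_tensor (actA := actA) (actB := actB) ρw (N.ρ.prod N'.ρ)
    (LinearMap.lTensor W (LinearMap.inl k N N') ∘ₗ u +
      LinearMap.lTensor W (LinearMap.inr k N N') ∘ₗ u')
    (v ∘ₗ LinearMap.lTensor W (LinearMap.fst k N N') +
      v' ∘ₗ LinearMap.lTensor W (LinearMap.snd k N N'))
    (fun g a => by
      simp only [LinearMap.add_apply, LinearMap.comp_apply, map_add, hu, hu']
      exact congrArg₂ (· + ·) (h₁ g _) (h₂ g _))
    (fun g p => by
      simp only [LinearMap.add_apply, LinearMap.comp_apply, map_add, ← hv, ← hv']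
      exact congrArg₂ (· + ·) (congrArg v (h₃ g p)) (congrArg v' (h₄ g p)))
  convert hQ using 1
  ext a
  simp only [LinearMap.add_apply, LinearMap.comp_apply, map_add, ← LinearMap.lTensor_comp_apply,
    LinearMap.fst_comp_inl, LinearMap.snd_comp_inl, LinearMap.fst_comp_inr,
    LinearMap.snd_comp_inr]
  simp

/-- The evaluation `w* ⊗ (w ⊗ N) → N`. -/
noncomputable def dualTensorEval (k W N : Type) [Field k] [AddCommGroup W] [Module k W]
    [AddCommGroup N] [Module k N] : Module.Dual k W ⊗[k] (W ⊗[k] N) →ₗ[k] N :=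
  (TensorProduct.lid k N).toLinearMap ∘ₗ LinearMap.rTensor N (contractLeft k W) ∘ₗ
    (TensorProduct.assoc k (Module.Dual k W) W N).symm.toLinearMap

@[simp]
theorem dualTensorEval_tmul (φ : Module.Dual k W) (w : W) (n : N) :
    dualTensorEval k W N (φ ⊗ₜ (w ⊗ₜ n)) = φ w • n := by
  simp [dualTensorEval]

theorem dualTensorEval_equivariant (g : G) (φ : Module.Dual k W) (z : W ⊗[k] N) :
    dualTensorEval k W N (ρw.dual g φ ⊗ₜ TensorProduct.map (ρw g) (ρN g) z) =
      ρN g (dualTensorEval k W N (φ ⊗ₜ z)) := by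
  induction z using TensorProduct.induction_on with
  | zero => simp
  | tmul w n => simp [Representation.dual_apply, Module.Dual.transpose_apply]
  | add a b ha hb => simp only [map_add, TensorProduct.tmul_add, ha, hb]

/-- The adjoint `w* ⊗ A → N` of a map `A → w ⊗ N`. -/
noncomputable def dualTensorAdjoint (p : A →ₗ[k] W ⊗[k] N) : Module.Dual k W ⊗[k] A →ₗ[k] N :=
  dualTensorEval k W N ∘ₗ LinearMap.lTensor (Module.Dual k W) p

theorem dualTensorAdjoint_equivariant (ρA : Representation k G A) (p : A →ₗ[k] W ⊗[k] N)
    (hp : ∀ g a, p (ρA g a) = TensorProduct.map (ρw g) (ρN g) (p a)) (g : G) :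
    dualTensorAdjoint p ∘ₗ TensorProduct.map (ρw.dual g) (ρA g) =
      ρN g ∘ₗ dualTensorAdjoint p := by
  ext φ a
  simpa [dualTensorAdjoint, hp] using dualTensorEval_equivariant ρw ρN g φ (p a)

section Unit

variable [FiniteDimensional k W]

theorem coevaluation_equivariant (g : G) :
    TensorProduct.map (ρw g) (ρw.dual g) (coevaluation k W 1) = coevaluation k W 1 := by
  have himage : dualTensorHom k W W (TensorProduct.comm k _ _ (coevaluation k W 1)) =
      LinearMap.id := by
    ext w
    rw [coevaluation_apply_one]
    simpa [LinearMap.sum_apply] using (Module.Basis.ofVectorSpace k W).sum_repr w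
  apply (TensorProduct.comm k W (Module.Dual k W)).injective
  apply (dualTensorHom_bijective (R := k) (M := W) (N := W)).injective
  have hcomm : TensorProduct.comm k W (Module.Dual k W)
      (TensorProduct.map (ρw g) (ρw.dual g) (coevaluation k W 1)) =
      TensorProduct.map (ρw.dual g) (ρw g)
        (TensorProduct.comm k W (Module.Dual k W) (coevaluation k W 1)) :=
    (TensorProduct.map_comm _ _ _).symm
  have h := LinearMap.congr_fun (Representation.dualTensorHom_comm ρw ρw g)
    (TensorProduct.comm k W (Module.Dual k W) (coevaluation k W 1))
  simp only [LinearMap.comp_apply] at h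
  rw [hcomm, h, himage]
  ext w
  simp [Representation.linHom_apply]

/-- The unit `A → w ⊗ (w* ⊗ A)`. -/
noncomputable def dualTensorUnit (k W A : Type) [Field k] [AddCommGroup W] [Module k W]
    [FiniteDimensional k W] [AddCommGroup A] [Module k A] :
    A →ₗ[k] W ⊗[k] (Module.Dual k W ⊗[k] A) :=
  (TensorProduct.assoc k W (Module.Dual k W) A).toLinearMap ∘ₗ
    TensorProduct.mk k (W ⊗[k] Module.Dual k W) A (coevaluation k W 1)

theorem dualTensorUnit_equivariant (ρA : Representation k G A) (g : G) (a : A) :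
    dualTensorUnit k W A (ρA g a) =
      TensorProduct.map (ρw g) (ρw.dual.tprod ρA g) (dualTensorUnit k W A a) := by
  have h := TensorProduct.map_map_assoc (ρw g) (ρw.dual g) (ρA g) (coevaluation k W 1 ⊗ₜ a)
  rw [TensorProduct.map_tmul, coevaluation_equivariant] at h
  exact h.symm

/-- Every map to `w ⊗ N` factors through the unit. -/
theorem lTensor_dualTensorAdjoint_unit (p : A →ₗ[k] W ⊗[k] N) :
    LinearMap.lTensor W (dualTensorAdjoint p) ∘ₗ dualTensorUnit k W A = p := by
  have key (z : W ⊗[k] N) : ∑ i, Module.Basis.ofVectorSpace k W i ⊗ₜ[k]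
      dualTensorEval k W N ((Module.Basis.ofVectorSpace k W).coord i ⊗ₜ z) = z := by
    induction z using TensorProduct.induction_on with
    | zero => simp
    | tmul w n =>
      simp only [dualTensorEval_tmul, ← TensorProduct.smul_tmul, ← TensorProduct.sum_tmul,
        Module.Basis.coord_apply, Module.Basis.sum_repr]
    | add a b ha hb =>
      simp only [map_add, TensorProduct.tmul_add, Finset.sum_add_distrib, ha, hb]
  ext a
  simpa [dualTensorUnit, coevaluation_apply_one, TensorProduct.sum_tmul, dualTensorAdjoint]
    using key (p a)

end Unit

end RelativeProjectivity

section Telescope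

open Filter

variable {k G : Type} [Field k] [Group G]
  {m : ℕ → Type} [∀ i, AddCommGroup (m i)] [∀ i, Module k (m i)]
  (ρm : ∀ i, Representation k G (m i)) (s : ∀ i, m i →ₗ[k] m (i + 1))

@[simp]
theorem dsAct_apply (g : G) (v : ⨁ i, m i) (i : ℕ) : dsAct m ρm g v i = ρm i g (v i) := by
  induction v using DirectSum.induction_on with
  | zero => simp
  | of j x =>
    rw [← DirectSum.lof_eq_of k]
    simp only [dsAct, DirectSum.toModule_lof, LinearMap.comp_apply]
    by_cases h : j = i
    · subst h; simp [DirectSum.lof_eq_of]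
    · simp [DirectSum.lof_eq_of, DirectSum.of_eq_of_ne _ _ _ (Ne.symm h)]
  | add a b ha hb => simp [ha, hb]

@[simp]
theorem dsAct_lof (g : G) (i : ℕ) (x : m i) :
    dsAct m ρm g (DirectSum.lof k ℕ m i x) = DirectSum.lof k ℕ m i (ρm i g x) := by
  simp [dsAct]

theorem dsShift_apply_zero (v : ⨁ i, m i) : dsShift m s v 0 = 0 := by
  induction v using DirectSum.induction_on with
  | zero => simp
  | of j x =>
    rw [← DirectSum.lof_eq_of k]
    simp only [dsShift, DirectSum.toModule_lof, LinearMap.comp_apply]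
    simp [DirectSum.lof_eq_of, DirectSum.of_eq_of_ne]
  | add a b ha hb => simp [ha, hb]

theorem dsShift_apply_succ (v : ⨁ i, m i) (i : ℕ) : dsShift m s v (i + 1) = s i (v i) := by
  induction v using DirectSum.induction_on with
  | zero => simp
  | of j x =>
    rw [← DirectSum.lof_eq_of k]
    simp only [dsShift, DirectSum.toModule_lof, LinearMap.comp_apply]
    by_cases h : j = i
    · subst h; simp [DirectSum.lof_eq_of]
    · have h' : i + 1 ≠ j + 1 := by omega
      simp [DirectSum.lof_eq_of, DirectSum.of_eq_of_ne _ _ _ (Ne.symm h),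
        DirectSum.of_eq_of_ne _ _ _ h']
  | add a b ha hb => simp [ha, hb]

/-- Push the components of index at most `n` forward to `m n` along the sequence and sum. -/
noncomputable def dsPush : ∀ n, (⨁ i, m i) →ₗ[k] m n
  | 0 => DirectSum.component k ℕ m 0
  | n + 1 => s n ∘ₗ dsPush n + DirectSum.component k ℕ m (n + 1)

theorem dsPush_equivariant (hs : ∀ (i : ℕ) (g : G) (a : m i), s i (ρm i g a) = ρm (i + 1) g (s i a))
    (g : G) (n : ℕ) (v : ⨁ i, m i) : dsPush s n (dsAct m ρm g v) = ρm n g (dsPush s n v) := by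
  induction n with
  | zero => simp [dsPush, ← DirectSum.apply_eq_component k]
  | succ n ih => simp [dsPush, ih, hs, ← DirectSum.apply_eq_component k]

theorem dsPush_sub_dsShift (n : ℕ) (v : ⨁ i, m i) : dsPush s n (v - dsShift m s v) = v n := by
  induction n with
  | zero => simp [dsPush, dsShift_apply_zero, ← DirectSum.apply_eq_component k]
  | succ n ih => simp [dsPush, ih, dsShift_apply_succ, ← DirectSum.apply_eq_component k]

theorem DirectSum.eventually_apply_eq_zero (v : ⨁ i, m i) : ∀ᶠ n in atTop, v n = 0 := by
  classical
  filter_upwards [eventually_gt_atTop (DFinsupp.support v |>.sup id)] with n hn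
  by_contra h
  exact absurd (Finset.le_sup (f := id) (DFinsupp.mem_support_iff.2 h)) (not_le.2 hn)

variable {M : Type} [AddCommGroup M] [Module k M] (t : (⨁ i, m i) →ₗ[k] M)

theorem apply_lof_dsPush_eq_sum (hst : ∀ v, t (dsShift m s v) = t v) (n : ℕ) (v : ⨁ i, m i) :
    t (DirectSum.lof k ℕ m n (dsPush s n v)) =
      ∑ i ∈ Finset.range (n + 1), t (DirectSum.lof k ℕ m i (v i)) := by
  induction n with
  | zero => simp [dsPush, ← DirectSum.apply_eq_component k]
  | succ n ih =>
    rw [Finset.sum_range_succ, ← ih, ← hst (DirectSum.lof k ℕ m n _)]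
    simp [dsPush, dsShift, ← DirectSum.apply_eq_component k]

theorem eventually_apply_lof_dsPush (hst : ∀ v, t (dsShift m s v) = t v) (v : ⨁ i, m i) :
    ∀ᶠ n in atTop, t (DirectSum.lof k ℕ m n (dsPush s n v)) = t v := by
  classical
  filter_upwards [eventually_ge_atTop (DFinsupp.support v |>.sup id)] with n hn
  rw [apply_lof_dsPush_eq_sum s t hst]
  conv_rhs => rw [← DirectSum.sum_support_of v, map_sum]
  simp only [← DirectSum.lof_eq_of k]
  refine (Finset.sum_subset (fun i hi => ?_) fun i _ hi => ?_).symm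
  · exact Finset.mem_range.2 (Nat.lt_succ_of_le ((Finset.le_sup (f := id) hi).trans hn))
  · rw [DFinsupp.notMem_support_iff.1 hi, map_zero, map_zero]

/-- Equivariant maps from a finite-dimensional module to the colimit of a sequence lift
equivariantly to the direct sum. -/
theorem exists_equivariant_lift [Finite G] (ρM : Representation k G M)
    (hs : ∀ (i : ℕ) (g : G) (a : m i), s i (ρm i g a) = ρm (i + 1) g (s i a))
    (ht : ∀ (g : G) (v : ⨁ i, m i), t (dsAct m ρm g v) = ρM g (t v))
    (htsurj : Function.Surjective t)
    (hexact : LinearMap.range (LinearMap.id - dsShift m s : (⨁ i, m i) →ₗ[k] ⨁ i, m i) =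
      LinearMap.ker t)
    {x : Type} [AddCommGroup x] [Module k x] [FiniteDimensional k x]
    (ρx : Representation k G x) (f : x →ₗ[k] M) (hf : ∀ g a, f (ρx g a) = ρM g (f a)) :
    ∃ h : x →ₗ[k] ⨁ i, m i,
      (∀ g a, h (ρx g a) = dsAct m ρm g (h a)) ∧ t ∘ₗ h = f := by
  have hst (v : ⨁ i, m i) : t (dsShift m s v) = t v := by
    have : v - dsShift m s v ∈ LinearMap.ker t := hexact ▸ ⟨v, rfl⟩
    rw [LinearMap.mem_ker, map_sub, sub_eq_zero] at this
    exact this.symm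
  obtain ⟨r, hr⟩ := LinearMap.exists_rightInverse_of_surjective t (LinearMap.range_eq_top.2 htsurj)
  have hr' (y : M) : t (r y) = y := LinearMap.congr_fun hr y
  let b := Module.finBasis k x
  have h₁ : ∀ᶠ n in atTop, ∀ j, t (DirectSum.lof k ℕ m n (dsPush s n (r (f (b j))))) = f (b j) :=
    eventually_all.2 fun j => by
      simpa only [hr'] using eventually_apply_lof_dsPush s t hst (r (f (b j)))
  have h₂ : ∀ᶠ n in atTop, ∀ (g : G) j,
      dsPush s n (r (f (ρx g (b j))) - dsAct m ρm g (r (f (b j)))) = 0 := by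
    refine eventually_all.2 fun g => eventually_all.2 fun j => ?_
    have hker : r (f (ρx g (b j))) - dsAct m ρm g (r (f (b j))) ∈ LinearMap.ker t := by
      rw [LinearMap.mem_ker, map_sub, ht, hr', hr', hf, sub_self]
    rw [← hexact] at hker
    obtain ⟨v, hv⟩ := hker
    filter_upwards [DirectSum.eventually_apply_eq_zero v] with n hn
    rw [← hv, LinearMap.sub_apply, LinearMap.id_apply, dsPush_sub_dsShift, hn]
  obtain ⟨n, h₁, h₂⟩ := (h₁.and h₂).exists
  refine ⟨DirectSum.lof k ℕ m n ∘ₗ dsPush s n ∘ₗ r ∘ₗ f, fun g a => ?_, b.ext h₁⟩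
  have hlin : (dsPush s n ∘ₗ r ∘ₗ f) ∘ₗ ρx g = ρm n g ∘ₗ (dsPush s n ∘ₗ r ∘ₗ f) :=
    b.ext fun j => by
      have h := h₂ g j
      rw [map_sub, dsPush_equivariant ρm s hs, sub_eq_zero] at h
      exact h
  have h := LinearMap.congr_fun hlin a
  simp only [LinearMap.comp_apply] at h ⊢
  rw [h, dsAct_lof]

end Telescope

/-- the natural map `λ : hocolim(mᵢ) → M` induces, for every
finite-dimensional module `x`, a bijection on homs from `x` in the relatively stable
category (maps modulo those factoring through `w`-projective modules). -/
theorem stmt_11 (k G : Type) [Field k] [Group G] [Finite G]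
    (W : Type) [AddCommGroup W] [Module k W] [FiniteDimensional k W]
    (ρw : Representation k G W)
    (m : ℕ → Type) [∀ i, AddCommGroup (m i)] [∀ i, Module k (m i)]
    [∀ i, FiniteDimensional k (m i)]
    (ρm : ∀ i, Representation k G (m i))
    (s : ∀ i, m i →ₗ[k] m (i + 1))
    (hs : ∀ (i : ℕ) (g : G) (a : m i), s i (ρm i g a) = ρm (i + 1) g (s i a))
    (M : Type) [AddCommGroup M] [Module k M] (ρM : Representation k G M)
    (t : (⨁ i, m i) →ₗ[k] M)
    (ht : ∀ (g : G) (v : ⨁ i, m i), t (dsAct m ρm g v) = ρM g (t v))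
    (htsurj : Function.Surjective t)
    (hinj : Function.Injective ((LinearMap.id - dsShift m s : (⨁ i, m i) →ₗ[k] ⨁ i, m i)))
    (hexact : LinearMap.range (LinearMap.id - dsShift m s : (⨁ i, m i) →ₗ[k] ⨁ i, m i) =
      LinearMap.ker t)
    (ι : (⨁ i, m i) →ₗ[k] (W ⊗[k] Module.Dual k W) ⊗[k] ⨁ i, m i)
    (hι : ι = LinearMap.rTensor (⨁ i, m i) (coevaluation k W) ∘ₗ
      (TensorProduct.lid k (⨁ i, m i)).symm.toLinearMap)
    (lam : HocolimCarrier m W s ι →ₗ[k] M)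
    (hlam : ∀ q : (⨁ i, m i) × ((W ⊗[k] Module.Dual k W) ⊗[k] ⨁ i, m i),
      lam (Submodule.Quotient.mk q) = t q.1)
    (actC : G → HocolimCarrier m W s ι →ₗ[k] HocolimCarrier m W s ι)
    (hactC : ∀ (g : G) (q : (⨁ i, m i) × ((W ⊗[k] Module.Dual k W) ⊗[k] ⨁ i, m i)),
      actC g (Submodule.Quotient.mk q) =
        Submodule.Quotient.mk (dsAct m ρm g q.1,
          TensorProduct.map (TensorProduct.map (ρw g) (ρw.dual g)) (dsAct m ρm g) q.2)) :
    ∀ (x : Type) [AddCommGroup x] [Module k x], FiniteDimensional k x →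
      ∀ ρx : Representation k G x,
      (∀ f : x →ₗ[k] M, (∀ (g : G) (a : x), f (ρx g a) = ρM g (f a)) →
        ∃ u : x →ₗ[k] HocolimCarrier m W s ι,
          (∀ (g : G) (a : x), u (ρx g a) = actC g (u a)) ∧
          FactorsThroughRelProj (Rep.of ρw) (fun g => ρx g) (fun g => ρM g)
            (f - lam ∘ₗ u)) ∧
      (∀ u : x →ₗ[k] HocolimCarrier m W s ι,
        (∀ (g : G) (a : x), u (ρx g a) = actC g (u a)) →
        FactorsThroughRelProj (Rep.of ρw) (fun g => ρx g) (fun g => ρM g) (lam ∘ₗ u) →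
        FactorsThroughRelProj (Rep.of ρw) (fun g => ρx g) actC u) := by
  intro x _ _ _ ρx
  let C := HocolimCarrier m W s ι
  let E := (W ⊗[k] Module.Dual k W) ⊗[k] ⨁ i, m i
  let inS : (⨁ i, m i) →ₗ[k] C := Submodule.mkQ _ ∘ₗ LinearMap.inl k (⨁ i, m i) E
  let inE : E →ₗ[k] C := Submodule.mkQ _ ∘ₗ LinearMap.inr k (⨁ i, m i) E
  have inS_act (g : G) (a : ⨁ i, m i) : inS (dsAct m ρm g a) = actC g (inS a) := by
    refine Eq.trans ?_ (hactC g (a, 0)).symm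
    exact congrArg (fun e : E => (Submodule.Quotient.mk (dsAct m ρm g a, e) : C))
      (map_zero _).symm
  have inE_act (g : G) (e : E) :
      inE (TensorProduct.map (TensorProduct.map (ρw g) (ρw.dual g)) (dsAct m ρm g) e) =
        actC g (inE e) := by
    refine Eq.trans ?_ (hactC g (0, e)).symm
    exact congrArg (fun a : ⨁ i, m i => (Submodule.Quotient.mk (a, _) : C)) (map_zero _).symm
  have lam_inS (a : ⨁ i, m i) : lam (inS a) = t a := hlam (a, 0)
  have inE_inj : Function.Injective inE := by
    rw [← LinearMap.ker_eq_bot, LinearMap.ker_eq_bot']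
    intro e he
    obtain ⟨a, ha⟩ := (Submodule.Quotient.mk_eq_zero _).1 he
    have h0 : a = 0 := hinj ((congrArg Prod.fst ha).trans (map_zero _).symm)
    rw [h0, map_zero] at ha
    exact (congrArg Prod.snd ha).symm
  have ker_le (c : C) (hc : lam c = 0) : c ∈ LinearMap.range inE := by
    obtain ⟨⟨a, e⟩, rfl⟩ := Submodule.Quotient.mk_surjective _ c
    have hat : a ∈ LinearMap.ker t := (hlam (a, e)).symm.trans hc
    rw [← hexact] at hat
    obtain ⟨v, hv⟩ := hat
    refine ⟨e - ι v, (Submodule.Quotient.eq _).2 ⟨-v, ?_⟩⟩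
    rw [map_neg]
    refine Prod.ext ?_ ?_
    · exact (congrArg Neg.neg hv).trans (zero_sub a).symm
    · exact (by simp : -(ι v) = e - ι v - e)
  refine ⟨fun f hf => ?_, fun u hu huM => ?_⟩
  · obtain ⟨h, hh, rfl⟩ := exists_equivariant_lift ρm s t ρM hs ht htsurj hexact ρx f hf
    refine ⟨inS ∘ₗ h, fun g a => ?_, ?_⟩
    · exact (congrArg inS (hh g a)).trans (inS_act g (h a))
    · rw [show t ∘ₗ h - lam ∘ₗ inS ∘ₗ h = 0 by ext a; simp [lam_inS]]
      exact FactorsThroughRelProj.zero ρw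
  · obtain ⟨N, p, v, hp, hv, hpv⟩ := huM.exists_tensor
    let ρx' := ρw.tprod (ρw.dual.tprod ρx)
    obtain ⟨h, hh, hth⟩ := exists_equivariant_lift ρm s t ρM hs ht htsurj hexact ρx'
      (v ∘ₗ LinearMap.lTensor W (dualTensorAdjoint p)) (fun g a => by
        have hq := dualTensorAdjoint_equivariant ρw N.ρ ρx p hp g
        rw [LinearMap.comp_apply, LinearMap.comp_apply, ← hv]
        congr 1
        simp only [ρx', Representation.tprod_apply, LinearMap.lTensor, ← LinearMap.comp_apply,
          ← TensorProduct.map_comp, hq, LinearMap.id_comp, LinearMap.comp_id])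
    let u' : x →ₗ[k] C := (inS ∘ₗ h) ∘ₗ dualTensorUnit k W x
    have inS_h (g : G) (z) : (inS ∘ₗ h) (ρx' g z) = actC g ((inS ∘ₗ h) z) :=
      (congrArg inS (hh g z)).trans (inS_act g (h z))
    have hu' (g : G) (a : x) : u' (ρx g a) = actC g (u' a) := by
      rw [LinearMap.comp_apply, dualTensorUnit_equivariant ρw ρx]
      exact inS_h g _
    have hd (a : x) : lam ((u - u') a) = 0 := by
      have h₁ := LinearMap.congr_fun hpv a
      have h₂ := LinearMap.congr_fun hth (dualTensorUnit k W x a)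
      have h₃ := LinearMap.congr_fun (lTensor_dualTensorAdjoint_unit p) a
      simp only [LinearMap.comp_apply] at h₁ h₂ h₃
      rw [LinearMap.sub_apply, map_sub, h₁, sub_eq_zero, ← h₃, ← h₂]
      exact (lam_inS _).symm
    let e : x →ₗ[k] E := (LinearEquiv.ofInjective inE inE_inj).symm.toLinearMap ∘ₗ
      (u - u').codRestrict (LinearMap.range inE) fun a => ker_le _ (hd a)
    have he (a : x) : inE (e a) = (u - u') a :=
      congrArg Subtype.val ((LinearEquiv.ofInjective inE inE_inj).apply_symm_apply _)
    have he_act (g : G) (a : x) : e (ρx g a) =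
        TensorProduct.map (TensorProduct.map (ρw g) (ρw.dual g)) (dsAct m ρm g) (e a) := by
      apply inE_inj
      rw [inE_act, he, he]
      simp only [LinearMap.sub_apply, map_sub, hu, hu']
    have hfac : u = (inS ∘ₗ h) ∘ₗ dualTensorUnit k W x +
        (inE ∘ₗ (TensorProduct.assoc k W (Module.Dual k W) (⨁ i, m i)).symm.toLinearMap) ∘ₗ
          ((TensorProduct.assoc k W (Module.Dual k W) (⨁ i, m i)).toLinearMap ∘ₗ e) := by
      ext a
      simp only [LinearMap.add_apply, LinearMap.comp_apply, LinearEquiv.coe_coe,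
        LinearEquiv.symm_apply_apply, he]
      simp [u']
    let ρS : Representation k G (⨁ i, m i) :=
      { toFun := dsAct m ρm
        map_one' := by ext; simp
        map_mul' := fun g g' => by ext; simp }
    rw [hfac]
    refine (FactorsThroughRelProj.of_tensor (N := Module.Dual k W ⊗[k] x) ρw
      (ρw.dual.tprod ρx) _ _ (dualTensorUnit_equivariant ρw ρx) inS_h).add ρw
      (FactorsThroughRelProj.of_tensor (N := Module.Dual k W ⊗[k] ⨁ i, m i) ρw
        (ρw.dual.tprod ρS) _ _ (fun g a => ?_) fun g z => ?_)
    · simp only [LinearMap.comp_apply, he_act]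
      exact (TensorProduct.map_map_assoc (ρw g) (ρw.dual g) (dsAct m ρm g) (e a)).symm
    · simp only [LinearMap.comp_apply, ← inE_act]
      exact congrArg inE
        (TensorProduct.map_map_assoc_symm (ρw g) (ρw.dual g) (dsAct m ρm g) z).symm
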